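/- Every (T_q,T_q)-biGalois object is isomorphic as a T_q-bicomodule algebra to L(ξ,μ) := L(ξ,μ,diag(G),1) for some ξ ∈ k^×, μ ∈ k; conversely, each L(ξ,μ) with ξ ≠ 0 is a (T_q,T_q)-biGalois object. -/

import Mathlib

open scoped TensorProduct

noncomputable section

/-- A left `H`-comodule algebra structure on the `k`-algebra `A`: the coaction is an algebra
map `A → H ⊗ A` which is coassociative and counital. -/
structure LeftComodAlg (k : Type*) [Field k] (H : Type*) [Ring H] [HopfAlgebra k H]
    (A : Type*) [Ring A] [Algebra k A] where
  ρ : A →ₐ[k] H ⊗[k] A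
  coassoc : ∀ a : A,
    TensorProduct.map (Coalgebra.comul (R := k)) LinearMap.id (ρ a) =
      (TensorProduct.assoc k H H A).symm (TensorProduct.map LinearMap.id ρ.toLinearMap (ρ a))
  counital : ∀ a : A,
    TensorProduct.map (Coalgebra.counit (R := k)) LinearMap.id (ρ a) = (1 : k) ⊗ₜ[k] a

namespace LeftComodAlg

variable {k : Type*} [Field k] {H : Type*} [Ring H] [HopfAlgebra k H]
  {A : Type*} [Ring A] [Algebra k A]

/-- The coinvariants of a comodule algebra are trivial. -/
def TrivialCoinv (c : LeftComodAlg k H A) : Prop :=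
  ∀ a : A, c.ρ a = (1 : H) ⊗ₜ[k] a → ∃ t : k, a = t • (1 : A)

/-- A submodule is costable if the coaction maps it into `H ⊗ I`. -/
def Costable (c : LeftComodAlg k H A) (I : Submodule k A) : Prop :=
  ∀ a ∈ I, c.ρ a ∈ LinearMap.range (LinearMap.lTensor H I.subtype)

/-- `A` is right `H`-simple: it has no nontrivial costable right ideal. -/
def RightHSimple (c : LeftComodAlg k H A) : Prop :=
  ∀ I : Submodule k A, (∀ a ∈ I, ∀ b : A, a * b ∈ I) → c.Costable I → I = ⊥ ∨ I = ⊤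

end LeftComodAlg

/-- A group-like element of a Hopf algebra. -/
def IsGrouplike (k : Type*) [Field k] {H : Type*} [Ring H] [HopfAlgebra k H] (g : H) : Prop :=
  g ≠ 0 ∧ Coalgebra.comul (R := k) g = g ⊗ₜ[k] g ∧ Coalgebra.counit (R := k) g = (1 : k)
/-- An `H`-bicomodule algebra: a `k`-algebra with a left and a right `H`-coaction, both
algebra maps, each coassociative and counital, and commuting with each other. -/
structure BicomodAlg (k : Type*) [Field k] (H : Type*) [Ring H] [HopfAlgebra k H]
    (A : Type*) [Ring A] [Algebra k A] where
  l : A →ₐ[k] H ⊗[k] A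
  r : A →ₐ[k] A ⊗[k] H
  lcoassoc : ∀ a : A,
    TensorProduct.map (Coalgebra.comul (R := k)) LinearMap.id (l a) =
      (TensorProduct.assoc k H H A).symm (TensorProduct.map LinearMap.id l.toLinearMap (l a))
  lcounital : ∀ a : A,
    TensorProduct.map (Coalgebra.counit (R := k)) LinearMap.id (l a) = (1 : k) ⊗ₜ[k] a
  rcoassoc : ∀ a : A,
    TensorProduct.map LinearMap.id (Coalgebra.comul (R := k)) (r a) =
      (TensorProduct.assoc k A H H) (TensorProduct.map r.toLinearMap LinearMap.id (r a))
  rcounital : ∀ a : A,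
    TensorProduct.map LinearMap.id (Coalgebra.counit (R := k)) (r a) = a ⊗ₜ[k] (1 : k)
  bicomod : ∀ a : A,
    TensorProduct.map l.toLinearMap LinearMap.id (r a) =
      (TensorProduct.assoc k H A H).symm (TensorProduct.map LinearMap.id r.toLinearMap (l a))

namespace BicomodAlg

variable {k : Type*} [Field k] {H : Type*} [Ring H] [HopfAlgebra k H]
  {A : Type*} [Ring A] [Algebra k A]

/-- The canonical (left) Galois map `A ⊗ A → H ⊗ A`, `a ⊗ b ↦ a₍₋₁₎ ⊗ a₍₀₎b`. -/
def lcan (b : BicomodAlg k H A) : A ⊗[k] A →ₗ[k] H ⊗[k] A :=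
  TensorProduct.map LinearMap.id (LinearMap.mul' k A) ∘ₗ
    (TensorProduct.assoc k H A A).toLinearMap ∘ₗ
      TensorProduct.map b.l.toLinearMap LinearMap.id

/-- The canonical (right) Galois map `A ⊗ A → A ⊗ H`, `a ⊗ b ↦ ab₍₀₎ ⊗ b₍₁₎`. -/
def rcan (b : BicomodAlg k H A) : A ⊗[k] A →ₗ[k] A ⊗[k] H :=
  TensorProduct.map (LinearMap.mul' k A) LinearMap.id ∘ₗ
    (TensorProduct.assoc k A A H).symm.toLinearMap ∘ₗ
      TensorProduct.map LinearMap.id b.r.toLinearMap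

/-- An `(H,H)`-biGalois object: both canonical maps are bijective, both coinvariant
subalgebras are trivial, and the algebra is nonzero. -/
structure IsBiGalois (b : BicomodAlg k H A) : Prop where
  one_ne_zero : (1 : A) ≠ 0
  lcan_bij : Function.Bijective b.lcan
  rcan_bij : Function.Bijective b.rcan
  lcoinv : ∀ a : A, b.l a = (1 : H) ⊗ₜ[k] a → ∃ t : k, a = t • (1 : A)
  rcoinv : ∀ a : A, b.r a = a ⊗ₜ[k] (1 : H) → ∃ t : k, a = t • (1 : A)

end BicomodAlg

/-- Conjugation `h ↦ S(g) * h * g` by a group-like element `g` (with inverse `S g`). -/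
def conjByGrouplike (k : Type*) [Field k] {H : Type*} [Ring H] [HopfAlgebra k H] (g : H) :
    H →ₗ[k] H :=
  LinearMap.mulLeft k (HopfAlgebra.antipode (R := k) g) ∘ₗ LinearMap.mulRight k g

/-- An isomorphism of `H`-bicomodule algebras. -/
def BicomodAlgIso {k : Type*} [Field k] {H : Type*} [Ring H] [HopfAlgebra k H]
    {A : Type*} [Ring A] [Algebra k A] {B : Type*} [Ring B] [Algebra k B]
    (bA : BicomodAlg k H A) (bB : BicomodAlg k H B) : Prop :=
  ∃ φ : A ≃ₐ[k] B,
    (∀ a : A, bB.l (φ a) = TensorProduct.map LinearMap.id φ.toLinearMap (bA.l a)) ∧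
    (∀ a : A, bB.r (φ a) = TensorProduct.map φ.toLinearMap LinearMap.id (bA.r a))

/-- An isomorphism of bicomodule algebras from `A^g` (the left coaction twisted by the
group-like element `g`) onto `B`. -/
def TwistedBicomodAlgIso {k : Type*} [Field k] {H : Type*} [Ring H] [HopfAlgebra k H]
    {A : Type*} [Ring A] [Algebra k A] {B : Type*} [Ring B] [Algebra k B]
    (g : H) (bA : BicomodAlg k H A) (bB : BicomodAlg k H B) : Prop :=
  ∃ φ : A ≃ₐ[k] B,
    (∀ a : A, bB.l (φ a) =
      TensorProduct.map (conjByGrouplike k g) φ.toLinearMap (bA.l a)) ∧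
    (∀ a : A, bB.r (φ a) = TensorProduct.map φ.toLinearMap LinearMap.id (bA.r a))
/-- A presentation of the Taft algebra `T_q`: a Hopf algebra `T` with generators `g, x`
satisfying `gⁿ = 1`, `xⁿ = 0`, `gx = q·xg`, with `g` group-like and
`Δ(x) = x ⊗ 1 + g ⊗ x`, `ε(x) = 0`, and with basis `{xⁱgʲ : 0 ≤ i,j < n}`. -/
structure TaftPres (k : Type*) [Field k] (n : ℕ) (q : k)
    (T : Type*) [Ring T] [HopfAlgebra k T] where
  g : T
  x : T
  g_pow : g ^ n = 1
  x_pow : x ^ n = 0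
  gx : g * x = q • (x * g)
  comul_g : Coalgebra.comul (R := k) g = g ⊗ₜ[k] g
  comul_x : Coalgebra.comul (R := k) x = x ⊗ₜ[k] 1 + g ⊗ₜ[k] x
  counit_g : Coalgebra.counit (R := k) g = (1 : k)
  counit_x : Coalgebra.counit (R := k) x = (0 : k)
  li : LinearIndependent k (fun p : Fin n × Fin n => x ^ (p.1 : ℕ) * g ^ (p.2 : ℕ))
  span : ⊤ ≤ Submodule.span k (Set.range fun p : Fin n × Fin n => x ^ (p.1 : ℕ) * g ^ (p.2 : ℕ))
/-- A presentation of the `T_q`-bicomodule algebra `L(ξ,μ) = L(ξ,μ,diag(G),1)`: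
it is generated by `w` and group elements `e_i` (`i ∈ ℤ/n`, `e_i = e_{(gⁱ,gⁱ)}`) with
relations `wⁿ = μ·1`, `e_i e_j = e_{i+j}`, `e_i w = qⁱ w e_i`, has basis `{e_i wʲ}`,
left `T_q`-coaction `λ(e_i) = gⁱ ⊗ e_i`, `λ(w) = ξ·x ⊗ 1 + g ⊗ w` and right `T_q`-coaction
`ρ(e_i) = e_i ⊗ gⁱ`, `ρ(w) = w ⊗ 1 + e₁ ⊗ x` (this is the `T_q`-bicomodule algebra
corresponding to the left `T_q ⊗ T_{q⁻¹}`-comodule algebra `L(ξ,μ,diag(G),1)` under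
`T_{q⁻¹} ≅ T_q^{cop}`). -/
structure LTaftPres {k : Type*} [Field k] {n : ℕ} {q : k}
    {T : Type*} [Ring T] [HopfAlgebra k T] (TP : TaftPres k n q T) (ξ μ : k)
    {A : Type*} [Ring A] [Algebra k A] (b : BicomodAlg k T A) where
  w : A
  e : ZMod n → A
  e_zero : e 0 = 1
  e_mul : ∀ i j : ZMod n, e i * e j = e (i + j)
  ew : ∀ i : ZMod n, e i * w = q ^ i.val • (w * e i)
  w_pow : w ^ n = μ • (1 : A)
  l_e : ∀ i : ZMod n, b.l (e i) = (TP.g ^ i.val) ⊗ₜ[k] e i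
  r_e : ∀ i : ZMod n, b.r (e i) = e i ⊗ₜ[k] (TP.g ^ i.val)
  l_w : b.l w = ξ • (TP.x ⊗ₜ[k] (1 : A)) + TP.g ⊗ₜ[k] w
  r_w : b.r w = w ⊗ₜ[k] (1 : T) + e 1 ⊗ₜ[k] TP.x
  li : LinearIndependent k (fun p : ZMod n × Fin n => e p.1 * w ^ (p.2 : ℕ))
  span : ⊤ ≤ Submodule.span k (Set.range fun p : ZMod n × Fin n => e p.1 * w ^ (p.2 : ℕ))

/-- A bundled `k`-algebra carrier. -/
structure AlgCar (k : Type u) [Field k] : Type (u + 1) where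
  A : Type u
  [ringA : Ring A]
  [algA : Algebra k A]

attribute [instance] AlgCar.ringA AlgCar.algA
section Contraction

variable {k V W X : Type*} [Field k] [AddCommGroup V] [Module k V] [AddCommGroup W] [Module k W]
  [AddCommGroup X] [Module k X]

/-- Contraction of the left tensor factor with a functional. -/
def leftContract (f : V →ₗ[k] k) : V ⊗[k] W →ₗ[k] W :=
  (TensorProduct.lid k W).toLinearMap ∘ₗ f.rTensor W

/-- Contraction of the right tensor factor with a functional. -/
def rightContract (f : W →ₗ[k] k) : V ⊗[k] W →ₗ[k] V :=
  (TensorProduct.rid k V).toLinearMap ∘ₗ f.lTensor V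

@[simp]
lemma leftContract_tmul (f : V →ₗ[k] k) (v : V) (w : W) :
    leftContract f (v ⊗ₜ[k] w) = f v • w := by
  simp [leftContract]

@[simp]
lemma rightContract_tmul (f : W →ₗ[k] k) (v : V) (w : W) :
    rightContract f (v ⊗ₜ[k] w) = f w • v := by
  simp [rightContract]

lemma eq_of_leftContract_eq {z z' : V ⊗[k] W}
    (h : ∀ f : V →ₗ[k] k, leftContract f z = leftContract f z') : z = z' := by
  classical
  let B := Module.Basis.ofVectorSpace k V
  apply (TensorProduct.equivFinsuppOfBasisLeft (N := W) B).injective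
  ext i
  rw [TensorProduct.equivFinsuppOfBasisLeft_apply, TensorProduct.equivFinsuppOfBasisLeft_apply]
  exact h (B.coord i)

lemma leftContract_map_id (f : V →ₗ[k] k) (g : W →ₗ[k] X) (z : V ⊗[k] W) :
    leftContract f (TensorProduct.map LinearMap.id g z) = g (leftContract f z) := by
  induction z with
  | zero => simp
  | tmul v w => simp
  | add a b ha hb => simp [ha, hb]

lemma leftContract_assoc_tmul (f : V →ₗ[k] k) (z : V ⊗[k] W) (t : X) :
    leftContract f (TensorProduct.assoc k V W X (z ⊗ₜ[k] t)) = leftContract f z ⊗ₜ[k] t := by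
  induction z with
  | zero => simp
  | tmul v w => simp [TensorProduct.smul_tmul']
  | add a b ha hb => simp [TensorProduct.add_tmul, ha, hb]

lemma exists_functional_eq_one {v : V} (hv : v ≠ 0) : ∃ f : V →ₗ[k] k, f v = 1 := by
  obtain ⟨f, hf⟩ : ∃ f : V →ₗ[k] k, f v ≠ 0 := by
    by_contra! h
    exact hv ((Module.forall_dual_apply_eq_zero_iff k v).1 h)
  exact ⟨(f v)⁻¹ • f, by simpa using inv_mul_cancel₀ hf⟩

lemma tmul_right_cancel {w : W} (hw : w ≠ 0) {v v' : V} (h : v ⊗ₜ[k] w = v' ⊗ₜ[k] w) :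
    v = v' := by
  obtain ⟨f, hf⟩ := exists_functional_eq_one (k := k) hw
  simpa [hf] using congrArg (rightContract f) h

lemma tmul_left_cancel {v : V} (hv : v ≠ 0) {w w' : W} (h : v ⊗ₜ[k] w = v ⊗ₜ[k] w') :
    w = w' := by
  obtain ⟨f, hf⟩ := exists_functional_eq_one (k := k) hv
  simpa [hf] using congrArg (leftContract f) h

/-- A tensor all of whose contractions lie on the line of `w` is a multiple of `w`. -/
lemma exists_eq_tmul {w : W} (hw : w ≠ 0) (z : V ⊗[k] W)
    (h : ∀ f : V →ₗ[k] k, ∃ c : k, leftContract f z = c • w) : ∃ v : V, z = v ⊗ₜ[k] w := by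
  obtain ⟨φ, hφ⟩ := exists_functional_eq_one (k := k) hw
  refine ⟨rightContract φ z, eq_of_leftContract_eq fun f => ?_⟩
  have key : ∀ y : V ⊗[k] W, f (rightContract φ y) = φ (leftContract f y) := fun y => by
    induction y with
    | zero => simp
    | tmul v w => simp [mul_comm]
    | add a b ha hb => simp [ha, hb]
  obtain ⟨c, hc⟩ := h f
  rw [leftContract_tmul, key, hc]
  simp [hφ]

end Contraction

section QBinomial

variable {k : Type*} [Field k]

/-- Gaussian binomial coefficients, defined by the `q`-Pascal rule. -/
def gaussBinom (q : k) : ℕ → ℕ → k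
  | _, 0 => 1
  | 0, _ + 1 => 0
  | m + 1, j + 1 => gaussBinom q m j + q ^ (j + 1) * gaussBinom q m (j + 1)

lemma gaussBinom_zero_right (q : k) (m : ℕ) : gaussBinom q m 0 = 1 := by
  cases m <;> rfl

lemma gaussBinom_eq_zero (q : k) {m j : ℕ} (h : m < j) : gaussBinom q m j = 0 := by
  induction m generalizing j with
  | zero => obtain ⟨j, rfl⟩ := Nat.exists_eq_succ_of_ne_zero h.ne'; rfl
  | succ m ih =>
    obtain ⟨j, rfl⟩ := Nat.exists_eq_succ_of_ne_zero (by omega : j ≠ 0)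
    rw [Nat.succ_eq_add_one, gaussBinom, ih (by omega), ih (by omega)]
    simp

lemma gaussBinom_self (q : k) (m : ℕ) : gaussBinom q m m = 1 := by
  induction m with
  | zero => rfl
  | succ m ih => rw [gaussBinom, ih, gaussBinom_eq_zero q (Nat.lt_succ_self m)]; simp

lemma gaussBinom_succ_succ_mul (q : k) (m j : ℕ) :
    (q ^ (j + 1) - 1) * gaussBinom q (m + 1) (j + 1) = (q ^ (m + 1) - 1) * gaussBinom q m j := by
  induction m generalizing j with
  | zero =>
    cases j with
    | zero => simp [gaussBinom]
    | succ j => simp [gaussBinom]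
  | succ m ih =>
    have h1 := ih j
    rw [gaussBinom]
    cases j with
    | zero =>
      rw [gaussBinom_zero_right] at h1 ⊢
      linear_combination q * h1
    | succ i =>
      have h2 := ih i
      have h3 : gaussBinom q (m + 1) (i + 1) =
        gaussBinom q m i + q ^ (i + 1) * gaussBinom q m (i + 1) := by rw [gaussBinom]
      linear_combination q ^ (i + 2) * h1 + (q ^ (m + 1) - 1) * q * (-h3) + q * h2

lemma add_pow_of_qcomm {R : Type*} [Ring R] [Algebra k R] {q : k} {X Y : R}
    (h : Y * X = q • (X * Y)) (m : ℕ) :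
    (X + Y) ^ m = ∑ p ∈ Finset.HasAntidiagonal.antidiagonal m, gaussBinom q m p.1 • (X ^ p.1 * Y ^ p.2) := by
  have hYX : ∀ j, Y * X ^ j = q ^ j • (X ^ j * Y) := fun j => by
    induction j with
    | zero => simp
    | succ j ih =>
      rw [pow_succ, ← mul_assoc, ih, smul_mul_assoc, mul_assoc, h, mul_smul_comm, smul_smul,
        mul_assoc, pow_succ]
  induction m with
  | zero => simp [gaussBinom]
  | succ m ih =>
    have hX : X * (X + Y) ^ m =
        ∑ p ∈ Finset.HasAntidiagonal.antidiagonal m, gaussBinom q m p.1 • (X ^ (p.1 + 1) * Y ^ p.2) := by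
      rw [ih, Finset.mul_sum]
      refine Finset.sum_congr rfl fun p _ => ?_
      rw [mul_smul_comm, ← mul_assoc, ← pow_succ']
    have hY : Y * (X + Y) ^ m =
        ∑ p ∈ Finset.HasAntidiagonal.antidiagonal (m + 1),
          (q ^ p.1 * gaussBinom q m p.1) • (X ^ p.1 * Y ^ p.2) := by
      rw [ih, Finset.mul_sum, Finset.Nat.sum_antidiagonal_succ', gaussBinom_eq_zero q (by simp),
        mul_zero, zero_smul, zero_add]
      refine Finset.sum_congr rfl fun p _ => ?_
      rw [mul_smul_comm, ← mul_assoc, hYX, smul_mul_assoc, smul_smul, mul_assoc, ← pow_succ',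
        mul_comm]
    rw [pow_succ', add_mul, hX, hY, Finset.Nat.sum_antidiagonal_succ,
      Finset.Nat.sum_antidiagonal_succ, ← add_assoc, add_comm (∑ p ∈ _, _), add_assoc,
      ← Finset.sum_add_distrib]
    simp [gaussBinom_zero_right, gaussBinom, add_smul]

lemma add_pow_of_isPrimitiveRoot {R : Type*} [Ring R] [Algebra k R] {q : k} {n : ℕ}
    (hn : 0 < n) (hq : IsPrimitiveRoot q n) {X Y : R} (h : Y * X = q • (X * Y)) :
    (X + Y) ^ n = X ^ n + Y ^ n := by
  obtain ⟨m, rfl⟩ := Nat.exists_eq_succ_of_ne_zero hn.ne'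
  rw [add_pow_of_qcomm h, Finset.Nat.sum_antidiagonal_succ, Finset.sum_eq_single (m, 0)]
  · simp [gaussBinom_zero_right, gaussBinom_self, add_comm]
  · rintro ⟨i, j⟩ hij hne
    have hlt : i < m := by
      have := Finset.HasAntidiagonal.mem_antidiagonal.1 hij
      rcases Nat.eq_zero_or_pos j with rfl | hj
      · exact absurd (by simpa using this) (by simpa using hne)
      · simp only at this; omega
    have := gaussBinom_succ_succ_mul q m i
    rw [← Nat.succ_eq_add_one m, hq.pow_eq_one, sub_self, zero_mul] at this
    have hne' : q ^ (i + 1) - 1 ≠ 0 :=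
      sub_ne_zero.2 (hq.pow_ne_one_of_pos_of_lt (by omega) (by omega))
    rw [(mul_eq_zero.1 this).resolve_left hne', zero_smul]
  · intro hm
    simp at hm

end QBinomial

namespace TaftPres

variable {k : Type*} [Field k] {n : ℕ} {q : k} {T : Type*} [Ring T] [HopfAlgebra k T]
  (TP : TaftPres k n q T)

/-- The monomial basis of the Taft algebra. -/
def basis : Module.Basis (Fin n × Fin n) k T := Module.Basis.mk TP.li TP.span

lemma basis_apply (p : Fin n × Fin n) : TP.basis p = TP.x ^ (p.1 : ℕ) * TP.g ^ (p.2 : ℕ) := by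
  simp [basis]

lemma finite (TP : TaftPres k n q T) : Module.Finite k T := Module.Finite.of_basis TP.basis

lemma finrank_eq (TP : TaftPres k n q T) : Module.finrank k T = n * n := by
  simp [Module.finrank_eq_card_basis TP.basis]

lemma nontrivial (TP : TaftPres k n q T) (hn : 0 < n) : Nontrivial T :=
  ⟨⟨_, 0, TP.basis.ne_zero (⟨0, hn⟩, ⟨0, hn⟩)⟩⟩

lemma induction_monomial {S : Submodule k T}
    (h : ∀ i j : ℕ, i < n → TP.x ^ i * TP.g ^ j ∈ S) (t : T) : t ∈ S := by
  have : Submodule.span k (Set.range fun p : Fin n × Fin n =>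
      TP.x ^ (p.1 : ℕ) * TP.g ^ (p.2 : ℕ)) ≤ S := by
    rw [Submodule.span_le]
    rintro _ ⟨p, rfl⟩
    exact h _ _ p.1.2
  exact this (TP.span Submodule.mem_top)

lemma g_mul_x_pow (i : ℕ) : TP.g * TP.x ^ i = q ^ i • (TP.x ^ i * TP.g) := by
  induction i with
  | zero => simp
  | succ i ih =>
    rw [pow_succ, ← mul_assoc, ih, smul_mul_assoc, mul_assoc, TP.gx, mul_smul_comm, smul_smul,
      ← pow_succ, mul_assoc]

/-- The coefficient functional of the monomials of degree one in `x`. -/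
def coeffOne : T →ₗ[k] k := TP.basis.constr k fun p => if (p.1 : ℕ) = 1 then 1 else 0

lemma coeffOne_monomial (hn : 2 ≤ n) (i j : ℕ) :
    TP.coeffOne (TP.x ^ i * TP.g ^ j) = if i = 1 then 1 else 0 := by
  by_cases hi : i < n
  · have hj : j % n < n := Nat.mod_lt _ (by omega)
    have := TP.basis.constr_basis k (fun p => if (p.1 : ℕ) = 1 then (1 : k) else 0)
      (⟨i, hi⟩, ⟨j % n, hj⟩)
    rw [basis_apply] at this
    rw [pow_eq_pow_mod j TP.g_pow]
    exact this
  · rw [pow_eq_zero_of_le (not_lt.1 hi) TP.x_pow, zero_mul, map_zero, if_neg (by omega)]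

lemma coeffOne_x_mul (hn : 2 ≤ n) (t : T) :
    TP.coeffOne (TP.x * t) = Coalgebra.counit (R := k) t := by
  refine TP.induction_monomial
    (S := LinearMap.eqLocus (TP.coeffOne ∘ₗ LinearMap.mulLeft k TP.x) Coalgebra.counit)
    (fun i j _ => ?_) t
  simp only [LinearMap.mem_eqLocus, LinearMap.comp_apply, LinearMap.mulLeft_apply]
  rw [← mul_assoc, ← pow_succ', TP.coeffOne_monomial hn, Bialgebra.counit_mul,
    Bialgebra.counit_pow, Bialgebra.counit_pow, TP.counit_g, TP.counit_x]
  rcases i with _ | i <;> simp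

lemma coeffOne_g_mul (hn : 2 ≤ n) (t : T) : TP.coeffOne (TP.g * t) = q * TP.coeffOne t := by
  refine TP.induction_monomial
    (S := LinearMap.eqLocus (TP.coeffOne ∘ₗ LinearMap.mulLeft k TP.g) (q • TP.coeffOne))
    (fun i j _ => ?_) t
  simp only [LinearMap.mem_eqLocus, LinearMap.comp_apply, LinearMap.mulLeft_apply,
    LinearMap.smul_apply]
  rw [← mul_assoc, g_mul_x_pow, smul_mul_assoc, mul_assoc, ← pow_succ', map_smul,
    TP.coeffOne_monomial hn, TP.coeffOne_monomial hn]
  split_ifs with h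
  · simp [h]
  · simp

/-- The `q`-derivation of the Taft algebra in the variable `x`. -/
def qderiv : T →ₗ[k] T := leftContract TP.coeffOne ∘ₗ Coalgebra.comul

lemma qderiv_x_mul (hn : 2 ≤ n) (t : T) :
    TP.qderiv (TP.x * t) = t + q • (TP.x * TP.qderiv t) := by
  have key : ∀ z : T ⊗[k] T, leftContract TP.coeffOne
      ((TP.x ⊗ₜ[k] 1 + TP.g ⊗ₜ[k] TP.x) * z) =
        leftContract Coalgebra.counit z + q • (TP.x * leftContract TP.coeffOne z) := fun z => by
    induction z with
    | zero => simp
    | tmul a b =>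
      simp [add_mul, TP.coeffOne_x_mul hn, TP.coeffOne_g_mul hn, mul_smul]
    | add a b ha hb => rw [mul_add, map_add, ha, hb]; simp only [map_add, mul_add, smul_add]; abel
  rw [qderiv, LinearMap.comp_apply, Bialgebra.comul_mul, TP.comul_x, key]
  simp [leftContract]

lemma qderiv_g_pow (hn : 2 ≤ n) (j : ℕ) : TP.qderiv (TP.g ^ j) = 0 := by
  rw [qderiv, LinearMap.comp_apply, Bialgebra.comul_pow, TP.comul_g,
    Algebra.TensorProduct.tmul_pow, leftContract_tmul]
  have := TP.coeffOne_monomial hn 0 j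
  rw [pow_zero, one_mul] at this
  simp [this]

lemma qderiv_monomial (hn : 2 ≤ n) (i j : ℕ) :
    TP.qderiv (TP.x ^ (i + 1) * TP.g ^ j) =
      (∑ m ∈ Finset.range (i + 1), q ^ m) • (TP.x ^ i * TP.g ^ j) := by
  induction i with
  | zero => simp [TP.qderiv_x_mul hn, TP.qderiv_g_pow hn]
  | succ i ih =>
    rw [pow_succ', mul_assoc, TP.qderiv_x_mul hn, ih, mul_smul_comm, ← mul_assoc, ← pow_succ',
      smul_smul, geom_sum_succ (n := i + 1), add_smul, one_smul, add_comm]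

lemma qderiv_iterate_monomial (hn : 2 ≤ n) (i j : ℕ) :
    (TP.qderiv ^ (i + 1)) (TP.x ^ i * TP.g ^ j) = 0 := by
  induction i with
  | zero => simp [TP.qderiv_g_pow hn]
  | succ i ih => rw [pow_succ, Module.End.mul_apply, TP.qderiv_monomial hn, map_smul, ih, smul_zero]

lemma qderiv_pow (hn : 2 ≤ n) (t : T) : (TP.qderiv ^ n) t = 0 := by
  refine TP.induction_monomial (S := LinearMap.ker (TP.qderiv ^ n)) (fun i j hi => ?_) t
  rw [LinearMap.mem_ker, ← pow_sub_mul_pow TP.qderiv (Nat.succ_le_of_lt hi),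
    Module.End.mul_apply, TP.qderiv_iterate_monomial hn, map_zero]

lemma eq_zero_of_qderiv_eq_smul (hn : 2 ≤ n) {t : T} {c : k} (h : TP.qderiv t = c • t)
    (ht : t ≠ 0) : c = 0 := by
  have hm : ∀ m : ℕ, (TP.qderiv ^ m) t = c ^ m • t := fun m => by
    induction m with
    | zero => simp
    | succ m ih => rw [pow_succ, Module.End.mul_apply, h, map_smul, ih, smul_smul, pow_succ']
  have := hm n
  rw [TP.qderiv_pow hn, eq_comm, smul_eq_zero] at this
  exact eq_zero_of_pow_eq_zero (this.resolve_right ht)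

lemma mem_adjoin_of_qderiv_eq_zero (hn : 2 ≤ n) (hq : IsPrimitiveRoot q n) {t : T}
    (h : TP.qderiv t = 0) : t ∈ Algebra.adjoin k {TP.g} := by
  let P : T →ₗ[k] T := TP.basis.constr k fun p =>
    (∑ m ∈ Finset.range (p.1 + 1), q ^ m)⁻¹ • (TP.x ^ (p.1 + 1 : ℕ) * TP.g ^ (p.2 : ℕ))
  have hP : ∀ i j : ℕ, i < n → P (TP.x ^ i * TP.g ^ j) =
      (∑ m ∈ Finset.range (i + 1), q ^ m)⁻¹ • (TP.x ^ (i + 1) * TP.g ^ j) := fun i j hi => by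
    have := TP.basis.constr_basis k (fun p => (∑ m ∈ Finset.range (p.1 + 1), q ^ m)⁻¹ •
      (TP.x ^ (p.1 + 1 : ℕ) * TP.g ^ (p.2 : ℕ))) (⟨i, hi⟩, ⟨j % n, Nat.mod_lt _ (by omega)⟩)
    rw [basis_apply] at this
    rw [pow_eq_pow_mod j TP.g_pow]
    exact this
  have key := TP.induction_monomial
    (S := (Subalgebra.toSubmodule (Algebra.adjoin k {TP.g})).comap
      (LinearMap.id - P ∘ₗ TP.qderiv)) (fun i j hi => ?_) t
  · simpa [h] using key
  · simp only [Submodule.mem_comap, Subalgebra.mem_toSubmodule, LinearMap.sub_apply,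
      LinearMap.id_apply, LinearMap.comp_apply]
    cases i with
    | zero =>
      simpa [TP.qderiv_g_pow hn] using
        pow_mem (Algebra.subset_adjoin (Set.mem_singleton TP.g)) j
    | succ i =>
      have hne : ∑ m ∈ Finset.range (i + 1), q ^ m ≠ 0 := by
        rw [geom_sum_eq (hq.ne_one (by omega))]
        exact div_ne_zero (sub_ne_zero.2 (hq.pow_ne_one_of_pos_of_lt (by omega) hi))
          (sub_ne_zero.2 (hq.ne_one (by omega)))
      rw [TP.qderiv_monomial hn, map_smul, hP _ _ (by omega), smul_smul, mul_inv_cancel₀ hne,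
        one_smul, sub_self]
      exact zero_mem _

/-- A skew-primitive element `q`-commuting with its group-like element is a multiple of `x`, and
the group-like element is `g` unless this multiple vanishes. -/
lemma skewPrimitive_eq (hn : 2 ≤ n) (hq : IsPrimitiveRoot q n) {h y : T} (hpow : h ^ n = 1)
    (hh : Coalgebra.comul (R := k) h = h ⊗ₜ[k] h)
    (hy : Coalgebra.comul (R := k) y = y ⊗ₜ[k] 1 + h ⊗ₜ[k] y) (hc : h * y = q • (y * h)) :
    ∃ ξ : k, y = ξ • TP.x ∧ (ξ ≠ 0 → h = TP.g) := by
  have := TP.nontrivial (by omega)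
  have h0 : h ≠ 0 := by
    rintro rfl
    simp [zero_pow (by omega : n ≠ 0)] at hpow
  have hq1 : 1 - q ≠ 0 := sub_ne_zero.2 (hq.ne_one (by omega)).symm
  have hDh : TP.qderiv h = TP.coeffOne h • h := by simp [qderiv, hh]
  have hc0 := TP.eq_zero_of_qderiv_eq_smul hn hDh h0
  rw [hc0, zero_smul] at hDh
  have hDy : TP.qderiv y = TP.coeffOne y • 1 := by simp [qderiv, hy, hc0]
  have hx1 : TP.qderiv TP.x = 1 := by simpa using TP.qderiv_monomial hn 0 0
  set ξ := TP.coeffOne y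
  have hDp : TP.qderiv (y - ξ • TP.x) = 0 := by rw [map_sub, map_smul, hDy, hx1, sub_self]
  have hpm := TP.mem_adjoin_of_qderiv_eq_zero hn hq hDp
  have hhm := TP.mem_adjoin_of_qderiv_eq_zero hn hq hDh
  obtain ⟨p, hp⟩ : ∃ p, p = y - ξ • TP.x := ⟨_, rfl⟩
  rw [← hp] at hpm
  have hyp : y = ξ • TP.x + p := by rw [hp]; abel
  have hcomm : ∀ a ∈ Algebra.adjoin k {TP.g}, ∀ b ∈ Algebra.adjoin k {TP.g}, a * b = b * a :=
    fun a ha b hb => congrArg Subtype.val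
      ((Algebra.isMulCommutative_adjoin k (s := {TP.g}) (by simp)).is_comm.comm ⟨a, ha⟩ ⟨b, hb⟩)
  have hgm : TP.g ∈ Algebra.adjoin k {TP.g} := Algebra.subset_adjoin (Set.mem_singleton _)
  have hz : (1 - q) • (h * p) = ξ • (q • (TP.x * h) - h * TP.x) := by
    rw [hyp, mul_add, add_mul, hcomm p hpm h hhm] at hc
    simp only [mul_smul_comm, smul_mul_assoc, smul_add] at hc
    rw [sub_smul, one_smul, smul_sub, smul_comm ξ q, sub_eq_sub_iff_add_eq_add, add_comm, hc]
  have hz1 : TP.g * (h * p) = (h * p) * TP.g := hcomm _ hgm _ (mul_mem hhm hpm)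
  have hz2 : TP.g * (h * p) = q • ((h * p) * TP.g) := by
    have hgh := hcomm _ hgm _ hhm
    have e1 : TP.g * (TP.x * h) = q • ((TP.x * h) * TP.g) := by
      rw [← mul_assoc, TP.gx, smul_mul_assoc, mul_assoc, hgh, mul_assoc]
    have e2 : TP.g * (h * TP.x) = q • ((h * TP.x) * TP.g) := by
      rw [← mul_assoc, hgh, mul_assoc, TP.gx, mul_smul_comm, mul_assoc]
    have e3 : TP.g * ((1 - q) • (h * p)) = q • (((1 - q) • (h * p)) * TP.g) := by
      rw [hz]
      simp only [mul_smul_comm, smul_mul_assoc, mul_sub, sub_mul, e1, e2, smul_sub,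
        smul_comm ξ q]
    rw [mul_smul_comm, smul_mul_assoc, smul_comm q] at e3
    exact smul_right_injective T hq1 e3
  have hp0 : p = 0 := by
    have e1 : (1 - q) • ((h * p) * TP.g) = 0 := by
      rw [sub_smul, one_smul, ← hz2, hz1, sub_self]
    have e2 := (smul_eq_zero.1 e1).resolve_left hq1
    have e3 : h * p = 0 := by
      have := congrArg (· * TP.g ^ (n - 1)) e2
      simpa [mul_assoc, ← pow_succ', Nat.sub_add_cancel (by omega : 1 ≤ n), TP.g_pow] using this
    have := congrArg (h ^ (n - 1) * ·) e3
    simpa [← mul_assoc, ← pow_succ, Nat.sub_add_cancel (by omega : 1 ≤ n), hpow] using this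
  rw [hp0, add_zero] at hyp
  refine ⟨ξ, hyp, fun hξ => ?_⟩
  rw [hyp, map_smul, TP.comul_x, smul_add, TensorProduct.smul_tmul', TensorProduct.smul_tmul',
    add_right_inj, TensorProduct.smul_tmul] at hy
  have hx0 : ξ • TP.x ≠ 0 := fun h => by
    rw [← hyp] at h
    have := hDy
    rw [h, map_zero, eq_comm, smul_eq_zero] at this
    exact this.elim hξ one_ne_zero
  exact (tmul_right_cancel hx0 hy).symm

end TaftPres

namespace BicomodAlg

variable {k : Type*} [Field k] {H : Type*} [Ring H] [HopfAlgebra k H]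
  {A : Type*} [Ring A] [Algebra k A] (b : BicomodAlg k H A)

lemma lcan_tmul (a c : A) : b.lcan (a ⊗ₜ[k] c) = b.l a * (1 ⊗ₜ[k] c) := by
  simp only [lcan, LinearMap.comp_apply, TensorProduct.map_tmul, LinearMap.id_apply,
    AlgHom.toLinearMap_apply, LinearEquiv.coe_coe]
  induction b.l a with
  | zero => simp
  | tmul x y => simp
  | add x y hx hy => simp only [TensorProduct.add_tmul, map_add, add_mul, hx, hy]

lemma rcan_tmul (a c : A) : b.rcan (a ⊗ₜ[k] c) = (a ⊗ₜ[k] 1) * b.r c := by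
  simp only [rcan, LinearMap.comp_apply, TensorProduct.map_tmul, LinearMap.id_apply,
    AlgHom.toLinearMap_apply, LinearEquiv.coe_coe]
  induction b.r c with
  | zero => simp
  | tmul x y => simp
  | add x y hx hy => simp only [TensorProduct.tmul_add, map_add, mul_add, hx, hy]

lemma eq_smul_one_of_tmul_comm (h1 : (1 : A) ≠ 0) {a : A}
    (h : a ⊗ₜ[k] (1 : A) = (1 : A) ⊗ₜ[k] a) : ∃ t : k, a = t • (1 : A) := by
  obtain ⟨f, hf⟩ := exists_functional_eq_one (k := k) h1
  exact ⟨f a, by simpa [hf] using (congrArg (leftContract f) h).symm⟩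

/-- Coinvariants are automatically trivial once the canonical maps are bijective. -/
lemma isBiGalois_of_bijective (h1 : (1 : A) ≠ 0) (hl : Function.Bijective b.lcan)
    (hr : Function.Bijective b.rcan) : b.IsBiGalois where
  one_ne_zero := h1
  lcan_bij := hl
  rcan_bij := hr
  lcoinv a ha := eq_smul_one_of_tmul_comm h1 <| hl.1 <| by
    rw [lcan_tmul, lcan_tmul, ha, map_one]; simp
  rcoinv a ha := eq_smul_one_of_tmul_comm h1 <| hr.1 <| by
    rw [rcan_tmul, rcan_tmul, ha, map_one]; simp

lemma counit_rcan (z : A ⊗[k] A) :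
    TensorProduct.map LinearMap.id (Coalgebra.counit (R := k)) (b.rcan z) =
      LinearMap.mul' k A z ⊗ₜ[k] (1 : k) := by
  have key : ∀ (a : A) (y : A ⊗[k] H),
      TensorProduct.map LinearMap.id (Coalgebra.counit (R := k)) ((a ⊗ₜ[k] 1) * y) =
        (a ⊗ₜ[k] (1 : k)) * TensorProduct.map LinearMap.id (Coalgebra.counit (R := k)) y :=
    fun a y => by
      induction y with
      | zero => simp
      | tmul y t => simp
      | add y y' h h' => simp only [mul_add, map_add, h, h']
  induction z with
  | zero => simp
  | tmul a c => rw [rcan_tmul, key, b.rcounital]; simp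
  | add z z' h h' => simp only [map_add, TensorProduct.add_tmul, h, h']

/-- The right canonical map is colinear for the coaction on the right tensor factor. -/
lemma comul_rcan (z : A ⊗[k] A) :
    TensorProduct.map LinearMap.id (Coalgebra.comul (R := k)) (b.rcan z) =
      TensorProduct.assoc k A H H (b.rcan.rTensor H ((TensorProduct.assoc k A A H).symm
        (TensorProduct.map LinearMap.id b.r.toLinearMap z))) := by
  have key₁ : ∀ (a : A) (y : A ⊗[k] H),
      TensorProduct.map LinearMap.id (Coalgebra.comul (R := k)) ((a ⊗ₜ[k] 1) * y) =
        (a ⊗ₜ[k] 1) * TensorProduct.map LinearMap.id (Coalgebra.comul (R := k)) y :=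
    fun a y => by
      induction y with
      | zero => simp
      | tmul y t => simp
      | add y y' h h' => simp only [mul_add, map_add, h, h']
  have key₃ : ∀ (a : A) (y : A ⊗[k] H) (t : H),
      TensorProduct.assoc k A H H (((a ⊗ₜ[k] (1 : H)) * y) ⊗ₜ[k] t) =
        (a ⊗ₜ[k] (1 : H ⊗[k] H)) * TensorProduct.assoc k A H H (y ⊗ₜ[k] t) :=
    fun a y t => by
      induction y with
      | zero => simp
      | tmul y t => simp
      | add y y' h h' => simp only [mul_add, map_add, TensorProduct.add_tmul, h, h']
  have key₂ : ∀ (a : A) (y : A ⊗[k] H),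
      TensorProduct.assoc k A H H (b.rcan.rTensor H ((TensorProduct.assoc k A A H).symm
        (a ⊗ₜ[k] y))) = (a ⊗ₜ[k] 1) *
          TensorProduct.assoc k A H H (TensorProduct.map b.r.toLinearMap LinearMap.id y) :=
    fun a y => by
      induction y with
      | zero => simp
      | tmul y t =>
        rw [TensorProduct.assoc_symm_tmul, LinearMap.rTensor_tmul, rcan_tmul, key₃]
        simp
      | add y y' h h' => simp only [mul_add, map_add, TensorProduct.tmul_add, h, h']
  induction z with
  | zero => simp
  | tmul a c =>
    rw [rcan_tmul, key₁, b.rcoassoc, TensorProduct.map_tmul, key₂]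
    simp
  | add z z' h h' => simp only [map_add, h, h']

variable {b}

lemma IsBiGalois.map_r_eq (hb : b.IsBiGalois) {z : A ⊗[k] A} {y : (A ⊗[k] A) ⊗[k] H}
    (h : TensorProduct.map LinearMap.id (Coalgebra.comul (R := k)) (b.rcan z) =
      TensorProduct.assoc k A H H (b.rcan.rTensor H y)) :
    TensorProduct.map LinearMap.id b.r.toLinearMap z = TensorProduct.assoc k A A H y := by
  have hinj : Function.Injective (b.rcan.rTensor H) :=
    Module.Flat.rTensor_preserves_injective_linearMap _ hb.rcan_bij.1
  rw [comul_rcan] at h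
  rw [← hinj ((TensorProduct.assoc k A H H).injective h), LinearEquiv.apply_symm_apply]

lemma IsBiGalois.r_leftContract (hb : b.IsBiGalois) {z : A ⊗[k] A} {t : H}
    (ht : Coalgebra.comul (R := k) t = t ⊗ₜ[k] t) (hz : b.rcan z = 1 ⊗ₜ[k] t) (f : A →ₗ[k] k) :
    b.r (leftContract f z) = leftContract f z ⊗ₜ[k] t := by
  rw [← leftContract_assoc_tmul, ← hb.map_r_eq (z := z) (y := z ⊗ₜ[k] t), leftContract_map_id]
  · rfl
  · simp [hz, ht]

lemma IsBiGalois.exists_ne_zero_mul (hb : b.IsBiGalois) [Nontrivial H] {t t' : H}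
    (ht : Coalgebra.comul (R := k) t = t ⊗ₜ[k] t)
    (ht' : Coalgebra.comul (R := k) t' = t' ⊗ₜ[k] t')
    (hε : Coalgebra.counit (R := k) t = (1 : k)) (ht0 : t' ≠ 0) :
    ∃ u v : A, b.r u = u ⊗ₜ[k] t ∧ b.r v = v ⊗ₜ[k] t' ∧ u * v ≠ 0 := by
  obtain ⟨z, hz⟩ := hb.rcan_bij.2 (1 ⊗ₜ[k] t)
  obtain ⟨z', hz'⟩ := hb.rcan_bij.2 (1 ⊗ₜ[k] t')
  by_contra! hcon
  have hmul : LinearMap.mul' k A z = 1 := by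
    have := b.counit_rcan z
    rw [hz] at this
    exact (tmul_right_cancel (_root_.one_ne_zero : (1 : k) ≠ 0) (by simpa [hε] using this)).symm
  have hv : ∀ v : A, b.r v = v ⊗ₜ[k] t' → v = 0 := fun v hv => by
    have hzero : TensorProduct.map LinearMap.id (LinearMap.mulRight k v) z = 0 :=
      eq_of_leftContract_eq fun f => by
        rw [leftContract_map_id, map_zero]
        exact hcon _ v (hb.r_leftContract ht hz f) hv
    have key : ∀ y : A ⊗[k] A, LinearMap.mul' k A
        (TensorProduct.map LinearMap.id (LinearMap.mulRight k v) y) =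
          LinearMap.mul' k A y * v := fun y => by
      induction y with
      | zero => simp
      | tmul a c => simp [mul_assoc]
      | add y y' h h' => simp only [map_add, add_mul, h, h']
    have := key z
    rwa [hzero, map_zero, hmul, one_mul, eq_comm] at this
  have hz0 : z' = 0 := eq_of_leftContract_eq fun f => by
    rw [map_zero]
    exact hv _ (hb.r_leftContract ht' hz' f)
  rw [hz0, map_zero] at hz'
  have : (1 : A) ⊗ₜ[k] t' = 1 ⊗ₜ[k] (0 : H) := by rw [← hz', TensorProduct.tmul_zero]
  exact ht0 (tmul_left_cancel hb.one_ne_zero this)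

lemma IsBiGalois.exists_skewPrimitive (hb : b.IsBiGalois) {t x : H} {u v : A}
    (hx : Coalgebra.comul (R := k) x = x ⊗ₜ[k] 1 + t ⊗ₜ[k] x) (hu : b.r u = u ⊗ₜ[k] t)
    (hvu : v * u = 1) : ∃ w : A, b.r w = w ⊗ₜ[k] 1 + u ⊗ₜ[k] x := by
  obtain ⟨z, hz⟩ := hb.rcan_bij.2 (1 ⊗ₜ[k] x)
  have hv : v ≠ 0 := by
    rintro rfl
    exact hb.one_ne_zero (by rw [← hvu, zero_mul])
  obtain ⟨f, hf⟩ := exists_functional_eq_one (k := k) hv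
  have key := hb.map_r_eq (z := z) (y := z ⊗ₜ[k] 1 + (v ⊗ₜ[k] u) ⊗ₜ[k] x)
    (by simp [hz, hx, rcan_tmul, hu, hvu, TensorProduct.tmul_add])
  refine ⟨leftContract f z, ?_⟩
  have := congrArg (leftContract f) key
  rw [leftContract_map_id, map_add, map_add, leftContract_assoc_tmul,
    leftContract_assoc_tmul] at this
  simpa [hf] using this

end BicomodAlg

namespace TaftPres

variable {k : Type*} [Field k] {n : ℕ} {q : k} {T : Type*} [Ring T] [HopfAlgebra k T]
  (TP : TaftPres k n q T) {A : Type*} [Ring A] [Algebra k A] (b : BicomodAlg k T A)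

/-- The right canonical map restricted to `A ⊗ B` is surjective as soon as `B` contains `1` and
is stable under right multiplication by the two generators. -/
lemma rcan_lTensor_surjective (TP : TaftPres k n q T) {B : Submodule k A} (h1 : 1 ∈ B) {u v w : A} (hvu : v * u = 1)
    (hBu : ∀ a ∈ B, a * u ∈ B) (hBw : ∀ a ∈ B, a * w ∈ B) (hu : b.r u = u ⊗ₜ[k] TP.g)
    (hw : b.r w = w ⊗ₜ[k] 1 + u ⊗ₜ[k] TP.x) :
    Function.Surjective (b.rcan ∘ₗ B.subtype.lTensor A) := by
  rw [← LinearMap.range_eq_top]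
  set R := LinearMap.range (b.rcan ∘ₗ B.subtype.lTensor A)
  have hmul : ∀ a c : A, (∀ s ∈ B, s * c ∈ B) → ∀ y ∈ R, (a ⊗ₜ[k] 1) * y * b.r c ∈ R := by
    rintro a c hc _ ⟨z, rfl⟩
    induction z with
    | zero => simp
    | tmul d s =>
      refine ⟨(a * d) ⊗ₜ[k] ⟨s * c, hc _ s.2⟩, ?_⟩
      simp [BicomodAlg.rcan_tmul, ← mul_assoc]
    | add z z' h h' =>
      rw [map_add, mul_add, add_mul]
      exact add_mem h h'
  have hleft : ∀ (a : A), ∀ y ∈ R, (a ⊗ₜ[k] 1) * y ∈ R := fun a y hy => by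
    simpa using hmul a 1 (by simp) y hy
  have hx : ∀ i : ℕ, (1 : A) ⊗ₜ[k] TP.x ^ i ∈ R := fun i => by
    induction i with
    | zero => exact ⟨1 ⊗ₜ[k] ⟨1, h1⟩, by simp [BicomodAlg.rcan_tmul, Algebra.TensorProduct.one_def]⟩
    | succ i ih =>
      have := sub_mem (hmul v w hBw _ ih) (hleft (v * w) _ ih)
      rw [hw] at this
      simpa [mul_add, hvu, ← pow_succ] using this
  have hxg : ∀ i j : ℕ, (1 : A) ⊗ₜ[k] (TP.x ^ i * TP.g ^ j) ∈ R := fun i j => by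
    induction j with
    | zero => simpa using hx i
    | succ j ih =>
      have := hmul v u hBu _ ih
      rw [hu] at this
      simpa [hvu, mul_assoc, ← pow_succ] using this
  have hone : ∀ t : T, (1 : A) ⊗ₜ[k] t ∈ R := fun t =>
    TP.induction_monomial (S := R.comap (TensorProduct.mk k A T 1)) (fun i j _ => hxg i j) t
  rw [eq_top_iff]
  rintro y -
  induction y with
  | zero => exact zero_mem _
  | tmul a t => simpa using hleft a _ (hone t)
  | add y y' h h' => exact add_mem h h'

lemma lcan_surjective (TP : TaftPres k n q T) {u v w : A} (huv : u * v = 1) {ξ : k} (hξ : ξ ≠ 0)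
    (hu : b.l u = TP.g ⊗ₜ[k] u) (hw : b.l w = ξ • (TP.x ⊗ₜ[k] 1) + TP.g ⊗ₜ[k] w) :
    Function.Surjective b.lcan := by
  rw [← LinearMap.range_eq_top]
  set R := LinearMap.range b.lcan
  have hmul : ∀ a c : A, ∀ y ∈ R, b.l a * y * (1 ⊗ₜ[k] c) ∈ R := by
    rintro a c _ ⟨z, rfl⟩
    induction z with
    | zero => simp
    | tmul d s =>
      refine ⟨(a * d) ⊗ₜ[k] (s * c), ?_⟩
      simp [BicomodAlg.lcan_tmul, mul_assoc]
    | add z z' h h' =>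
      rw [map_add, mul_add, add_mul]
      exact add_mem h h'
  have hright : ∀ (c : A), ∀ y ∈ R, y * (1 ⊗ₜ[k] c) ∈ R := fun c y hy => by
    simpa using hmul 1 c y hy
  have hg : ∀ t : T, t ⊗ₜ[k] (1 : A) ∈ R → (TP.g * t) ⊗ₜ[k] (1 : A) ∈ R := fun t ht => by
    simpa [hu, huv] using hmul u v _ ht
  have hgj : ∀ j : ℕ, (TP.g ^ j) ⊗ₜ[k] (1 : A) ∈ R := fun j => by
    induction j with
    | zero => exact ⟨1 ⊗ₜ[k] 1, by simp [BicomodAlg.lcan_tmul]⟩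
    | succ j ih => rw [pow_succ']; exact hg _ ih
  have hxg : ∀ i j : ℕ, (TP.x ^ i * TP.g ^ j) ⊗ₜ[k] (1 : A) ∈ R := fun i j => by
    induction i with
    | zero => simpa using hgj j
    | succ i ih =>
      have := sub_mem (hmul w 1 _ ih) (hright w _ (hg _ ih))
      rw [hw] at this
      have h2 := R.smul_mem ξ⁻¹ this
      simpa [add_mul, hξ, smul_smul, ← mul_assoc, ← pow_succ'] using h2
  have hone : ∀ t : T, t ⊗ₜ[k] (1 : A) ∈ R := fun t =>
    TP.induction_monomial (S := R.comap ((TensorProduct.mk k T A).flip 1))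
      (fun i j _ => hxg i j) t
  rw [eq_top_iff]
  rintro y -
  induction y with
  | zero => exact zero_mem _
  | tmul t a => simpa using hright a _ (hone t)
  | add y y' h h' => exact add_mem h h'

variable {TP b}

/-- Every `L(ξ, μ)` with `ξ ≠ 0` is a biGalois object. -/
lemma isBiGalois_of_LTaftPres (hn : 2 ≤ n) {ξ μ : k} (hξ : ξ ≠ 0) (L : LTaftPres TP ξ μ b) :
    b.IsBiGalois := by
  have : NeZero n := ⟨by omega⟩
  have hval : (1 : ZMod n).val = 1 := by
    rw [ZMod.val_one_eq_one_mod, Nat.mod_eq_of_lt (by omega)]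
  have h1 : (1 : A) ≠ 0 := by
    simpa [L.e_zero] using L.li.ne_zero (0, (⟨0, by omega⟩ : Fin n))
  have hvu : L.e (-1) * L.e 1 = 1 := by rw [L.e_mul, neg_add_cancel, L.e_zero]
  have huv : L.e 1 * L.e (-1) = 1 := by rw [L.e_mul, add_neg_cancel, L.e_zero]
  let B := Module.Basis.mk L.li L.span
  have : Module.Finite k A := Module.Finite.of_basis B
  have : Module.Finite k T := TP.finite
  have hfA : Module.finrank k A = n * n := by simp [Module.finrank_eq_card_basis B]
  have hr : Function.Surjective b.rcan := by
    have := TP.rcan_lTensor_surjective b (B := ⊤) Submodule.mem_top hvu (by simp) (by simp)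
      (by simpa [hval] using L.r_e 1) L.r_w
    exact Function.Surjective.of_comp (g := (⊤ : Submodule k A).subtype.lTensor A) this
  have hl : Function.Surjective b.lcan :=
    TP.lcan_surjective b huv hξ (by simpa [hval] using L.l_e 1) L.l_w
  refine b.isBiGalois_of_bijective h1 ⟨?_, hl⟩ ⟨?_, hr⟩
  · exact (LinearMap.injective_iff_surjective_of_finrank_eq_finrank
      (by simp [Module.finrank_tensorProduct, hfA, TP.finrank_eq])).2 hl
  · exact (LinearMap.injective_iff_surjective_of_finrank_eq_finrank
      (by simp [Module.finrank_tensorProduct, hfA, TP.finrank_eq])).2 hr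

/-- The weight spaces of the right coaction contain elements `u` with `ρ(u) = u ⊗ g`, `uⁿ = 1`. -/
lemma exists_weight_unit [IsAlgClosed k] (TP : TaftPres k n q T) (hn : 2 ≤ n)
    (hb : b.IsBiGalois) : ∃ u : A, b.r u = u ⊗ₜ[k] TP.g ∧ u ^ n = 1 := by
  have := TP.nontrivial (by omega)
  have hn1 : n - 1 + 1 = n := by omega
  have hgi : ∀ i : ℕ, Coalgebra.comul (R := k) (TP.g ^ i) = (TP.g ^ i) ⊗ₜ[k] (TP.g ^ i) :=
    fun i => by rw [Bialgebra.comul_pow, TP.comul_g, Algebra.TensorProduct.tmul_pow]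
  have hg0 : TP.g ^ (n - 1) ≠ 0 := fun h => one_ne_zero (α := T) <| by
    rw [← TP.g_pow, ← pow_sub_one_mul (by omega) TP.g, h, zero_mul]
  obtain ⟨u₀, v₀, hu₀, hv₀, huv⟩ := hb.exists_ne_zero_mul TP.comul_g (hgi (n - 1)) TP.counit_g hg0
  obtain ⟨c, hc⟩ := hb.rcoinv (u₀ * v₀) (by
    rw [map_mul, hu₀, hv₀, Algebra.TensorProduct.tmul_mul_tmul, ← pow_succ', hn1, TP.g_pow])
  obtain ⟨c', hc'⟩ := hb.rcoinv (v₀ * u₀) (by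
    rw [map_mul, hu₀, hv₀, Algebra.TensorProduct.tmul_mul_tmul, ← pow_succ, hn1, TP.g_pow])
  obtain ⟨d, hd⟩ := hb.rcoinv (u₀ ^ n) (by
    rw [map_pow, hu₀, Algebra.TensorProduct.tmul_pow, TP.g_pow])
  have hu0 : u₀ ≠ 0 := by
    rintro rfl
    exact huv (zero_mul _)
  have hc0 : c ≠ 0 := by
    rintro rfl
    exact huv (by rw [hc, zero_smul])
  have hcc : c' = c := by
    have h1 : u₀ * (v₀ * u₀) = (u₀ * v₀) * u₀ := (mul_assoc _ _ _).symm
    rw [hc, hc', mul_smul_comm, smul_mul_assoc, mul_one, one_mul] at h1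
    exact smul_left_injective k hu0 h1
  have hunit : IsUnit u₀ := ⟨⟨u₀, c⁻¹ • v₀, by simp [hc, smul_smul, hc0],
    by simp [hc', hcc, smul_smul, hc0]⟩, rfl⟩
  have : Nontrivial A := ⟨⟨1, 0, hb.one_ne_zero⟩⟩
  have hd0 : d ≠ 0 := by
    rintro rfl
    exact (hunit.pow n).ne_zero (by rw [hd, zero_smul])
  obtain ⟨r, hr⟩ := IsAlgClosed.exists_pow_nat_eq d (by omega : 0 < n)
  refine ⟨r⁻¹ • u₀, by rw [map_smul, hu₀, TensorProduct.smul_tmul'], ?_⟩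
  rw [smul_pow, hd, smul_smul, inv_pow, hr, inv_mul_cancel₀ hd0, one_smul]

/-- The skew-primitive generator can be chosen to `q`-commute with the group-like one. -/
lemma exists_skewPrimitive_qcomm (hn : 2 ≤ n) (hq : IsPrimitiveRoot q n) (hb : b.IsBiGalois)
    {u : A} (hu : b.r u = u ⊗ₜ[k] TP.g) (hun : u ^ n = 1) :
    ∃ w : A, b.r w = w ⊗ₜ[k] 1 + u ⊗ₜ[k] TP.x ∧ u * w = q • (w * u) := by
  have hn1 : n - 1 + 1 = n := by omega
  have hvu : u ^ (n - 1) * u = 1 := by rw [← pow_succ, hn1, hun]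
  have huv : u * u ^ (n - 1) = 1 := by rw [← pow_succ', hn1, hun]
  have hgg : TP.g * TP.g ^ (n - 1) = 1 := by rw [← pow_succ', hn1, TP.g_pow]
  obtain ⟨w, hw⟩ := hb.exists_skewPrimitive TP.comul_x hu hvu
  have hq1 : q - 1 ≠ 0 := sub_ne_zero.2 (hq.ne_one (by omega))
  obtain ⟨c, hc⟩ := hb.rcoinv (u * w * u ^ (n - 1) - q • w) (by
    have hgx : TP.g * TP.x * TP.g ^ (n - 1) = q • TP.x := by
      rw [TP.gx, smul_mul_assoc, mul_assoc, hgg, mul_one]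
    rw [map_sub, map_smul, map_mul, map_mul, map_pow, hu, hw, Algebra.TensorProduct.tmul_pow,
      mul_add, add_mul]
    simp only [Algebra.TensorProduct.tmul_mul_tmul, mul_one, hgg, hgx, mul_assoc u u, huv]
    rw [TensorProduct.sub_tmul, TensorProduct.tmul_smul, smul_add, TensorProduct.smul_tmul']
    abel)
  refine ⟨w + (c / (q - 1)) • 1, ?_, ?_⟩
  · rw [map_add, map_smul, map_one, hw, TensorProduct.add_tmul, Algebra.TensorProduct.one_def,
      TensorProduct.smul_tmul']
    abel
  · have h1 : u * w = q • (w * u) + c • u := by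
      have := congrArg (· * u) (sub_eq_iff_eq_add.1 hc)
      simp only [mul_assoc, hvu, mul_one, add_mul, smul_mul_assoc, one_mul] at this
      rw [this, add_comm]
    have h2 : c = (q - 1) * (c / (q - 1)) := (mul_div_cancel₀ c hq1).symm
    rw [mul_add, add_mul, h1, mul_smul_comm, smul_mul_assoc, mul_one, one_mul, smul_add, smul_smul]
    nth_rw 1 [h2]
    rw [sub_mul, one_mul, sub_smul]
    abel

/-- The left coaction on the generators is `λ(u) = g ⊗ u`, `λ(w) = ξ x ⊗ 1 + g ⊗ w`. -/
lemma exists_left_coaction_eq (hn : 2 ≤ n) (hq : IsPrimitiveRoot q n) (hb : b.IsBiGalois)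
    {u w : A} (hu : b.r u = u ⊗ₜ[k] TP.g) (hun : u ^ n = 1)
    (hw : b.r w = w ⊗ₜ[k] 1 + u ⊗ₜ[k] TP.x) (huw : u * w = q • (w * u)) :
    ∃ ξ : k, ξ ≠ 0 ∧ b.l u = TP.g ⊗ₜ[k] u ∧
      b.l w = ξ • (TP.x ⊗ₜ[k] (1 : A)) + TP.g ⊗ₜ[k] w := by
  have := TP.nontrivial (by omega)
  have hn1 : n - 1 + 1 = n := by omega
  have hvu : u ^ (n - 1) * u = 1 := by rw [← pow_succ, hn1, hun]
  have hgg : TP.g * TP.g ^ (n - 1) = 1 := by rw [← pow_succ', hn1, TP.g_pow]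
  have hu0 : u ≠ 0 := by
    rintro rfl
    exact hb.one_ne_zero (by rw [← hvu, mul_zero])
  have hrl : ∀ a : A, TensorProduct.map LinearMap.id b.r.toLinearMap (b.l a) =
      TensorProduct.assoc k T A T
        (TensorProduct.map b.l.toLinearMap LinearMap.id (b.r a)) := fun a => by
    rw [b.bicomod, LinearEquiv.apply_symm_apply]
  obtain ⟨h, hh⟩ : ∃ h : T, b.l u = h ⊗ₜ[k] u := by
    refine exists_eq_tmul hu0 _ fun f => ?_
    have hf : b.r (leftContract f (b.l u)) = leftContract f (b.l u) ⊗ₜ[k] TP.g := by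
      rw [← leftContract_assoc_tmul, ← AlgHom.toLinearMap_apply b.r, ← leftContract_map_id, hrl,
        hu, TensorProduct.map_tmul]
      rfl
    obtain ⟨c, hc⟩ := hb.rcoinv (leftContract f (b.l u) * u ^ (n - 1)) (by
      rw [map_mul, map_pow, hf, hu, Algebra.TensorProduct.tmul_pow,
        Algebra.TensorProduct.tmul_mul_tmul, hgg])
    refine ⟨c, ?_⟩
    simpa [mul_assoc, hvu] using congrArg (· * u) hc
  obtain ⟨y, hy⟩ : ∃ y : T, b.l w - h ⊗ₜ[k] w = y ⊗ₜ[k] (1 : A) := by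
    refine exists_eq_tmul hb.one_ne_zero _ fun f => hb.rcoinv _ ?_
    rw [← leftContract_assoc_tmul, ← AlgHom.toLinearMap_apply b.r, ← leftContract_map_id, map_sub,
      hrl, hw]
    congr 1
    simp [hh, hw, TensorProduct.tmul_add, TensorProduct.sub_tmul]
  have hlw : b.l w = y ⊗ₜ[k] 1 + h ⊗ₜ[k] w := sub_eq_iff_eq_add.1 hy
  have hΔh : Coalgebra.comul (R := k) h = h ⊗ₜ[k] h := by
    have := b.lcoassoc u
    rw [hh] at this
    exact tmul_right_cancel hu0 (by simpa [hh] using this)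
  have hΔy : Coalgebra.comul (R := k) y = y ⊗ₜ[k] 1 + h ⊗ₜ[k] y := by
    have := b.lcoassoc w
    rw [hlw] at this
    refine tmul_right_cancel hb.one_ne_zero (?_ : _ ⊗ₜ[k] (1 : A) = _)
    simpa [hΔh, hlw, TensorProduct.tmul_add, TensorProduct.add_tmul, ← add_assoc,
      Algebra.TensorProduct.one_def] using this
  have hhn : h ^ n = 1 := by
    have : b.l (u ^ n) = (h ^ n) ⊗ₜ[k] (1 : A) := by
      rw [map_pow, hh, Algebra.TensorProduct.tmul_pow, hun]
    rw [hun, map_one, Algebra.TensorProduct.one_def] at this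
    exact (tmul_right_cancel hb.one_ne_zero this).symm
  have hhy : h * y = q • (y * h) := by
    have := congrArg b.l huw
    rw [map_smul, map_mul, map_mul, hh, hlw, mul_add, add_mul] at this
    simp only [Algebra.TensorProduct.tmul_mul_tmul, mul_one, one_mul, huw, smul_add,
      TensorProduct.tmul_smul, add_left_inj] at this
    rw [TensorProduct.smul_tmul'] at this
    exact tmul_right_cancel hu0 this
  obtain ⟨ξ, hξ, hg⟩ := TP.skewPrimitive_eq hn hq hhn hΔh hΔy hhy
  have hξ0 : ξ ≠ 0 := by
    rintro rfl
    rw [zero_smul] at hξ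
    rw [hξ, TensorProduct.zero_tmul, zero_add] at hlw
    obtain ⟨c, hc⟩ := hb.lcoinv (w * u ^ (n - 1)) (by
      rw [map_mul, map_pow, hh, hlw, Algebra.TensorProduct.tmul_pow,
        Algebra.TensorProduct.tmul_mul_tmul, ← pow_succ', hn1, hhn])
    have hwu : w = c • u := by simpa [mul_assoc, hvu] using congrArg (· * u) hc
    rw [hwu, map_smul, hu] at hw
    have hx : c • TP.g = c • 1 + TP.x := by
      refine tmul_left_cancel (k := k) hu0 ?_
      rw [TensorProduct.tmul_add, TensorProduct.tmul_smul, hw, TensorProduct.tmul_smul,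
        TensorProduct.smul_tmul']
    have hD := congrArg TP.qderiv hx
    have h0 := TP.qderiv_g_pow hn 0
    have h1 := TP.qderiv_g_pow hn 1
    rw [pow_zero] at h0
    rw [pow_one] at h1
    have h2 : TP.qderiv TP.x = 1 := by simpa using TP.qderiv_monomial hn 0 0
    rw [map_add, map_smul, map_smul, h0, h1, h2, smul_zero, zero_add] at hD
    exact zero_ne_one hD
  refine ⟨ξ, hξ0, by rw [hh, hg hξ0], ?_⟩
  rw [hlw, hξ, hg hξ0, TensorProduct.smul_tmul']

lemma finrank_eq_of_isBiGalois (TP : TaftPres k n q T) (hb : b.IsBiGalois) [Module.Finite k A] :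
    Module.finrank k A = n * n := by
  have : Nontrivial A := ⟨⟨1, 0, hb.one_ne_zero⟩⟩
  have := (LinearEquiv.ofBijective b.rcan hb.rcan_bij).finrank_eq
  rw [Module.finrank_tensorProduct, Module.finrank_tensorProduct, TP.finrank_eq] at this
  exact Nat.eq_of_mul_eq_mul_left Module.finrank_pos this

/-- A biGalois object has no proper subspace containing `1` and stable under right
multiplication by the two generators. -/
lemma eq_top_of_isBiGalois (TP : TaftPres k n q T) (hb : b.IsBiGalois) {B : Submodule k A} (h1 : 1 ∈ B) {u v w : A}
    (hvu : v * u = 1) (hBu : ∀ a ∈ B, a * u ∈ B) (hBw : ∀ a ∈ B, a * w ∈ B)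
    (hu : b.r u = u ⊗ₜ[k] TP.g) (hw : b.r w = w ⊗ₜ[k] 1 + u ⊗ₜ[k] TP.x) : B = ⊤ := by
  rw [eq_top_iff]
  rintro a -
  obtain ⟨z, hz⟩ := TP.rcan_lTensor_surjective b h1 hvu hBu hBw hu hw (b.rcan (1 ⊗ₜ[k] a))
  have hz' := hb.rcan_bij.1 hz
  obtain ⟨f, hf⟩ := exists_functional_eq_one (k := k) hb.one_ne_zero
  have := congrArg (leftContract f) hz'
  rw [LinearMap.lTensor, leftContract_map_id, leftContract_tmul, hf, one_smul] at this
  rw [← this]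
  exact (leftContract f z).2

lemma exists_LTaftPres [IsAlgClosed k] (hn : 2 ≤ n) (hq : IsPrimitiveRoot q n)
    (hb : b.IsBiGalois) : ∃ ξ μ : k, ξ ≠ 0 ∧ Nonempty (LTaftPres TP ξ μ b) := by
  have : NeZero n := ⟨by omega⟩
  have hn1 : n - 1 + 1 = n := by omega
  have hval : (1 : ZMod n).val = 1 := by
    rw [ZMod.val_one_eq_one_mod, Nat.mod_eq_of_lt (by omega)]
  obtain ⟨u, hu, hun⟩ := TP.exists_weight_unit hn hb
  obtain ⟨w, hw, huw⟩ := exists_skewPrimitive_qcomm hn hq hb hu hun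
  obtain ⟨ξ, hξ, hlu, hlw⟩ := exists_left_coaction_eq hn hq hb hu hun hw huw
  obtain ⟨μ, hμ⟩ := hb.rcoinv (w ^ n) (by
    rw [map_pow, hw, add_pow_of_isPrimitiveRoot (by omega) hq, Algebra.TensorProduct.tmul_pow,
      Algebra.TensorProduct.tmul_pow, TP.x_pow, one_pow, TensorProduct.tmul_zero, add_zero]
    simp [huw, TensorProduct.smul_tmul'])
  have hvu : u ^ (n - 1) * u = 1 := by rw [← pow_succ, hn1, hun]
  have hpow_w : ∀ i : ℕ, u ^ i * w = q ^ i • (w * u ^ i) := fun i => by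
    induction i with
    | zero => simp
    | succ i ih =>
      rw [pow_succ, mul_assoc, huw, mul_smul_comm, ← mul_assoc, ih, smul_mul_assoc, smul_smul,
        ← pow_succ', mul_assoc]
  have hu_pow : ∀ j : ℕ, u * w ^ j = q ^ j • (w ^ j * u) := fun j => by
    induction j with
    | zero => simp
    | succ j ih =>
      rw [pow_succ, ← mul_assoc, ih, smul_mul_assoc, mul_assoc, huw, mul_smul_comm, smul_smul,
        ← pow_succ, mul_assoc]
  have hpow_u : ∀ j : ℕ, w ^ j * u = (q ^ j)⁻¹ • (u * w ^ j) := fun j => by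
    rw [hu_pow, smul_smul, inv_mul_cancel₀ (pow_ne_zero _ (hq.ne_zero (by omega))), one_smul]
  let e : ZMod n → A := fun i => u ^ i.val
  set B := Submodule.span k (Set.range fun p : ZMod n × Fin n => e p.1 * w ^ (p.2 : ℕ)) with hB
  have hmem : ∀ i j : ℕ, u ^ i * w ^ j ∈ B := fun i j => by
    have h1 : u ^ i = e i := by
      simp only [e, ZMod.val_natCast]
      exact pow_eq_pow_mod i hun
    have h2 : w ^ j = μ ^ (j / n) • w ^ (j % n) := by
      conv_lhs => rw [← Nat.div_add_mod j n, pow_add, pow_mul, hμ, smul_pow, one_pow,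
        smul_mul_assoc, one_mul]
    rw [h1, h2, mul_smul_comm]
    exact B.smul_mem _ (Submodule.subset_span
      ⟨((i : ZMod n), (⟨j % n, Nat.mod_lt _ (by omega)⟩ : Fin n)), rfl⟩)
  have hstable : ∀ c : A, (∀ i j : ℕ, u ^ i * w ^ j * c ∈ B) → ∀ a ∈ B, a * c ∈ B := by
    intro c hc
    have : B ≤ B.comap (LinearMap.mulRight k c) := by
      conv_lhs => rw [hB]
      rw [Submodule.span_le]
      rintro _ ⟨p, rfl⟩
      exact hc _ _
    exact this
  have htop : B = ⊤ := TP.eq_top_of_isBiGalois hb (by simpa using hmem 0 0) hvu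
    (hstable u fun i j => by
      rw [mul_assoc, hpow_u, mul_smul_comm, ← mul_assoc, ← pow_succ]
      exact B.smul_mem _ (hmem _ _))
    (hstable w fun i j => by
      rw [mul_assoc, ← pow_succ]
      exact hmem _ _) hu hw
  have : Module.Finite k A := ⟨⟨(Set.finite_range _).toFinset, by
    rw [Set.Finite.coe_toFinset]; exact htop⟩⟩
  refine ⟨ξ, μ, hξ, ⟨{
    w := w
    e := e
    e_zero := by simp [e]
    e_mul := fun i j => by
      simp only [e]
      rw [← pow_add, ZMod.val_add, ← pow_eq_pow_mod _ hun]
    ew := fun i => hpow_w _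
    w_pow := hμ
    l_e := fun i => by simp only [e]; rw [map_pow, hlu, Algebra.TensorProduct.tmul_pow]
    r_e := fun i => by simp only [e]; rw [map_pow, hu, Algebra.TensorProduct.tmul_pow]
    l_w := hlw
    r_w := by simpa [e, hval] using hw
    li := linearIndependent_of_top_le_span_of_card_eq_finrank htop.ge
      (by simp [TP.finrank_eq_of_isBiGalois hb])
    span := htop.ge }⟩⟩

end TaftPres

/-- Every `(T_q,T_q)`-biGalois object is isomorphic as a `T_q`-bicomodule
algebra to `L(ξ,μ) := L(ξ,μ,diag(G),1)` for some `ξ ∈ k^×`, `μ ∈ k` (equivalently: it admits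
an `L(ξ,μ)`-presentation); conversely each `L(ξ,μ)` with `ξ ≠ 0` is a `(T_q,T_q)`-biGalois
object. -/
theorem taft_biGalois_classification
    {k : Type*} [Field k] [IsAlgClosed k] [CharZero k]
    {n : ℕ} (hn : 2 ≤ n) {q : k} (hq : IsPrimitiveRoot q n)
    {T : Type*} [Ring T] [HopfAlgebra k T] (TP : TaftPres k n q T) :
    (∀ (C : AlgCar k) (b : BicomodAlg k T C.A), b.IsBiGalois →
        ∃ ξ μ : k, ξ ≠ 0 ∧ Nonempty (LTaftPres TP ξ μ b)) ∧
    (∀ (C : AlgCar k) (ξ μ : k), ξ ≠ 0 → ∀ b : BicomodAlg k T C.A,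
        Nonempty (LTaftPres TP ξ μ b) → b.IsBiGalois) := by
  exact ⟨fun _ _ hb => TaftPres.exists_LTaftPres hn hq hb,
    fun _ _ _ hξ _ ⟨L⟩ => TaftPres.isBiGalois_of_LTaftPres hn hξ L⟩
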